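/- Under the asymptotic one-shot random-canary setup, for any δ ∈ (0,1), the estimate ε̂_d = ε(N(0, 1/d) ‖ N(μ̂_d, σ̂_d²); δ) produced by the one-shot privacy-estimation algorithm converges in probability, as d → ∞, to the constant ε(N(0, σ²) ‖ N(1, σ²); δ), the true privacy parameter of the Gaussian mechanism with noise standard deviation σ and sensitivity 1. -/

import Mathlib

open MeasureTheory ProbabilityTheory Real Filter
open scoped InnerProductSpace Topology ENNReal

/-- The standard Gaussian measure `N(0, I_d)` on `ℝ^d`, obtained by mapping the product
of `d` independent one-dimensional standard Gaussians onto `EuclideanSpace ℝ (Fin d)`. -/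
noncomputable def stdGaussianE (d : ℕ) : Measure (EuclideanSpace ℝ (Fin d)) :=
  Measure.map (⇑(EuclideanSpace.equiv (Fin d) ℝ).symm)
    (Measure.pi fun _ : Fin d => gaussianReal 0 1)

/-- The joint distribution of `k` i.i.d. canaries `c_1, …, c_k` drawn from the
(uniform) measure `μs` on the unit sphere, together with an independent standard
Gaussian vector `Z ∼ N(0, I_d)`.  A sample point is `ω = ((c_1, …, c_k), Z)`. -/
noncomputable def canaryP (d k : ℕ) (μs : Measure (EuclideanSpace ℝ (Fin d))) :
    Measure ((Fin k → EuclideanSpace ℝ (Fin d)) × EuclideanSpace ℝ (Fin d)) :=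
  (Measure.pi fun _ : Fin k => μs).prod (stdGaussianE d)

/-- The mechanism output `ρ = X + ∑_{i=1}^k c_i + σ Z`. -/
noncomputable def rhoF (d k : ℕ) (X : EuclideanSpace ℝ (Fin d)) (σ : ℝ)
    (ω : (Fin k → EuclideanSpace ℝ (Fin d)) × EuclideanSpace ℝ (Fin d)) :
    EuclideanSpace ℝ (Fin d) :=
  X + (∑ i, ω.1 i) + σ • ω.2

/-- The cosine statistic `g_i = ⟪c_i, ρ⟫ / ‖ρ‖` of the `i`-th canary. -/
noncomputable def cosStat (d k : ℕ) (X : EuclideanSpace ℝ (Fin d)) (σ : ℝ)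
    (ω : (Fin k → EuclideanSpace ℝ (Fin d)) × EuclideanSpace ℝ (Fin d)) (i : Fin k) : ℝ :=
  ⟪ω.1 i, rhoF d k X σ ω⟫_ℝ / ‖rhoF d k X σ ω‖

/-- The empirical mean `μ̂ = (1/k) ∑ᵢ g_i` of the canary cosines. -/
noncomputable def muHat (d k : ℕ) (X : EuclideanSpace ℝ (Fin d)) (σ : ℝ)
    (ω : (Fin k → EuclideanSpace ℝ (Fin d)) × EuclideanSpace ℝ (Fin d)) : ℝ :=
  (1 / k : ℝ) * ∑ i, cosStat d k X σ ω i

/-- The empirical variance `σ̂² = (1/k) ∑ᵢ (g_i - μ̂)²` of the canary cosines. -/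
noncomputable def sigmaHatSq (d k : ℕ) (X : EuclideanSpace ℝ (Fin d)) (σ : ℝ)
    (ω : (Fin k → EuclideanSpace ℝ (Fin d)) × EuclideanSpace ℝ (Fin d)) : ℝ :=
  (1 / k : ℝ) * ∑ i, (cosStat d k X σ ω i - muHat d k X σ ω) ^ 2

/-- `ε(P ‖ Q; δ)`: the smallest `ε ≥ 0` such that the pair of probability measures
`(P, Q)` on `ℝ` satisfies `(ε, δ)`-indistinguishability, i.e. for every measurable
`S ⊆ ℝ`, `P(S) ≤ e^ε Q(S) + δ` and `Q(S) ≤ e^ε P(S) + δ`. -/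
noncomputable def epsDP (P Q : Measure ℝ) (δ : ℝ) : ℝ :=
  sInf {ε : ℝ | 0 ≤ ε ∧ ∀ S : Set ℝ, MeasurableSet S →
    P S ≤ ENNReal.ofReal (Real.exp ε) * Q S + ENNReal.ofReal δ ∧
    Q S ≤ ENNReal.ofReal (Real.exp ε) * P S + ENNReal.ofReal δ}

/-- feasibility -/
def Feas (P Q : Measure ℝ) (δ ε : ℝ) : Prop :=
  0 ≤ ε ∧ ∀ S : Set ℝ, MeasurableSet S →
    P S ≤ ENNReal.ofReal (Real.exp ε) * Q S + ENNReal.ofReal δ ∧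
    Q S ≤ ENNReal.ofReal (Real.exp ε) * P S + ENNReal.ofReal δ

lemma epsDP_eq (P Q : Measure ℝ) (δ : ℝ) : epsDP P Q δ = sInf {ε | Feas P Q δ ε} := rfl

lemma meas_le_iff (P Q : Measure ℝ) [IsProbabilityMeasure P] [IsProbabilityMeasure Q] (S : Set ℝ)
    {δ a : ℝ} (hδ : 0 ≤ δ) (ha : 0 ≤ a) :
    P S ≤ ENNReal.ofReal a * Q S + ENNReal.ofReal δ ↔ P.real S ≤ a * Q.real S + δ := by
  rw [← ofReal_measureReal (μ := P), ← ofReal_measureReal (μ := Q), ← ENNReal.ofReal_mul ha,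
    ← ENNReal.ofReal_add (by positivity) hδ, ENNReal.ofReal_le_ofReal_iff (by positivity)]

lemma feas_iff (P Q : Measure ℝ) [IsProbabilityMeasure P] [IsProbabilityMeasure Q]
    {δ ε : ℝ} (hδ : 0 ≤ δ) : Feas P Q δ ε ↔ 0 ≤ ε ∧ ∀ S : Set ℝ, MeasurableSet S →
      P.real S ≤ Real.exp ε * Q.real S + δ ∧ Q.real S ≤ Real.exp ε * P.real S + δ := by
  simp only [Feas, meas_le_iff _ _ _ hδ (Real.exp_pos ε).le]

lemma feas_shift (P Q Q' : Measure ℝ) [IsProbabilityMeasure P] [IsProbabilityMeasure Q]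
    [IsProbabilityMeasure Q'] {δ c τ η ε : ℝ} (hδ : 0 ≤ δ) (hc : 0 < c) (hτ : 0 ≤ τ)
    (hη0 : 0 ≤ η) (hη : 1 + τ / c ≤ Real.exp η)
    (h1 : ∀ S, MeasurableSet S → δ < P.real S → c ≤ Q'.real S)
    (h2 : ∀ S, MeasurableSet S → δ < Q'.real S → c ≤ P.real S)
    (h3 : ∀ S, MeasurableSet S → |Q.real S - Q'.real S| ≤ τ)
    (hf : Feas P Q δ ε) : Feas P Q' δ (ε + η) := by
  rw [feas_iff _ _ hδ] at hf ⊢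
  obtain ⟨h0, hf⟩ := hf
  refine ⟨by positivity, fun S hS => ?_⟩
  obtain ⟨ha, hb⟩ := hf S hS
  have h3' := abs_le.1 (h3 S hS)
  have he : 1 ≤ Real.exp ε := Real.one_le_exp h0
  rw [Real.exp_add]
  have key : ∀ x, c ≤ x → x + τ ≤ Real.exp η * x := by
    intro x hx
    have : τ ≤ τ / c * x := by
      rw [div_mul_eq_mul_div, le_div_iff₀ hc]
      exact mul_le_mul_of_nonneg_left hx hτ
    nlinarith
  constructor
  · rcases le_or_gt (P.real S) δ with h | h
    · have : 0 ≤ Real.exp ε * Real.exp η * Q'.real S := by positivity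
      linarith
    · have := key _ (h1 S hS h)
      nlinarith
  · rcases le_or_gt (Q'.real S) δ with h | h
    · have : 0 ≤ Real.exp ε * Real.exp η * P.real S := by positivity
      linarith
    · have := key _ (h2 S hS h)
      nlinarith

lemma feas_exists (P Q : Measure ℝ) [IsProbabilityMeasure P] [IsProbabilityMeasure Q]
    {δ c : ℝ} (hδ : 0 ≤ δ) (hc : 0 < c)
    (h1 : ∀ S, MeasurableSet S → δ < P.real S → c ≤ Q.real S)
    (h2 : ∀ S, MeasurableSet S → δ < Q.real S → c ≤ P.real S) : ∃ ε, Feas P Q δ ε := by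
  refine ⟨|Real.log c⁻¹|, ?_⟩
  rw [feas_iff _ _ hδ]
  refine ⟨by positivity, fun S hS => ?_⟩
  have he : c⁻¹ ≤ Real.exp |Real.log c⁻¹| := by
    calc c⁻¹ = Real.exp (Real.log c⁻¹) := (Real.exp_log (by positivity)).symm
      _ ≤ _ := Real.exp_le_exp.2 (le_abs_self _)
  have key : ∀ x, c ≤ x → 1 ≤ Real.exp |Real.log c⁻¹| * x := by
    intro x hx
    calc (1:ℝ) = c⁻¹ * c := by field_simp
      _ ≤ _ := by gcongr
  constructor
  · rcases le_or_gt (P.real S) δ with h | h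
    · have : 0 ≤ Real.exp |Real.log c⁻¹| * Q.real S := by positivity
      linarith
    · have := key _ (h1 S hS h)
      have : P.real S ≤ 1 := measureReal_le_one
      linarith
  · rcases le_or_gt (Q.real S) δ with h | h
    · have : 0 ≤ Real.exp |Real.log c⁻¹| * P.real S := by positivity
      linarith
    · have := key _ (h2 S hS h)
      have : Q.real S ≤ 1 := measureReal_le_one
      linarith

lemma quant_ac (P Q : Measure ℝ) [IsProbabilityMeasure P] [IsProbabilityMeasure Q] (h : P ≪ Q)
    {δ : ℝ} (hδ : 0 < δ) : ∃ c > 0, ∀ S, MeasurableSet S → δ < P.real S → c ≤ Q.real S := by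
  have hfin : ∫⁻ x, P.rnDeriv Q x ∂Q ≠ ∞ := by
    rw [Measure.lintegral_rnDeriv h]; simp
  obtain ⟨c, hc, H⟩ := exists_pos_setLIntegral_lt_of_measure_lt hfin
    (ε := ENNReal.ofReal δ) (by simpa using hδ)
  refine ⟨(min c 1).toReal, ?_, fun S hS hP => ?_⟩
  · apply ENNReal.toReal_pos
    · exact (lt_min hc one_pos).ne'
    · exact ((min_le_right _ _).trans_lt ENNReal.one_lt_top).ne
  · by_contra hlt
    push Not at hlt
    have hm : min c 1 ≠ ∞ := ((min_le_right _ _).trans_lt ENNReal.one_lt_top).ne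
    have : Q S < min c 1 := by
      rwa [measureReal_def, ENNReal.toReal_lt_toReal (measure_ne_top _ _) hm] at hlt
    have := H S (this.trans_le (min_le_left _ _))
    rw [Measure.setLIntegral_rnDeriv h] at this
    rw [measureReal_def] at hP
    have h2 := (ENNReal.lt_ofReal_iff_toReal_lt (measure_ne_top _ _)).1 this
    linarith

lemma gauss_ac (m m' : ℝ) {v v' : NNReal} (hv : v ≠ 0) (hv' : v' ≠ 0) :
    gaussianReal m v ≪ gaussianReal m' v' :=
  (gaussianReal_absolutelyContinuous m hv).trans (gaussianReal_absolutelyContinuous' m' hv')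

lemma pdf_bound (m₀ : ℝ) (p : ℝ × ℝ) (h1 : |p.1 - m₀| ≤ 1) (h2 : 1/2 ≤ p.2) (h3 : p.2 ≤ 2) (x : ℝ) :
    gaussianPDFReal p.1 p.2.toNNReal x ≤ Real.exp (1/2) * Real.exp (-(1/8) * (x - m₀)^2) := by
  rw [gaussianPDFReal, Real.coe_toNNReal _ (by linarith), ← Real.exp_add]
  have ha : (√(2 * π * p.2))⁻¹ ≤ 1 := by
    apply inv_le_one_of_one_le₀
    rw [Real.one_le_sqrt]
    nlinarith [Real.pi_gt_three]
  have hb : -(x - p.1)^2 / (2 * p.2) ≤ 1/2 + -(1/8) * (x - m₀)^2 := by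
    rw [div_le_iff₀ (by linarith)]
    have h4 : (p.1 - m₀)^2 ≤ 1 := by
      have := abs_le.1 h1; nlinarith
    have : (x - m₀)^2 ≤ 2 * (x - p.1)^2 + 2 := by
      nlinarith [sq_nonneg ((x - p.1) - (p.1 - m₀))]
    nlinarith [sq_nonneg (x - m₀), sq_nonneg (x - p.1)]
  calc _ ≤ 1 * Real.exp (-(x - p.1)^2 / (2 * p.2)) := by gcongr
    _ ≤ _ := by rw [one_mul]; exact Real.exp_le_exp.2 hb

lemma tv_tendsto (m₀ : ℝ) : Tendsto (fun p : ℝ × ℝ =>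
    ∫ x, |gaussianPDFReal p.1 p.2.toNNReal x - gaussianPDFReal m₀ 1 x|) (𝓝 (m₀, 1)) (𝓝 0) := by
  have h0 : (0:ℝ) = ∫ x : ℝ, (0:ℝ) := by simp
  rw [h0]
  have hev : ∀ᶠ p : ℝ × ℝ in 𝓝 (m₀, 1), |p.1 - m₀| ≤ 1 ∧ 1/2 ≤ p.2 ∧ p.2 ≤ 2 := by
    have e1 : ∀ᶠ p : ℝ × ℝ in 𝓝 (m₀, 1), |p.1 - m₀| < 1 := by
      refine Filter.Tendsto.eventually_lt_const (f := fun p : ℝ × ℝ => |p.1 - m₀|) ?_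
        (Continuous.tendsto (by fun_prop) _)
      simp
    have e2 : ∀ᶠ p : ℝ × ℝ in 𝓝 (m₀, 1), p.2 < 2 := by
      refine Filter.Tendsto.eventually_lt_const (f := fun p : ℝ × ℝ => p.2) ?_
        (Continuous.tendsto (by fun_prop) _)
      norm_num
    have e3 : ∀ᶠ p : ℝ × ℝ in 𝓝 (m₀, 1), 1/2 < p.2 := by
      refine Filter.Tendsto.eventually_const_lt (f := fun p : ℝ × ℝ => p.2) ?_
        (Continuous.tendsto (by fun_prop) _)
      norm_num
    filter_upwards [e1, e2, e3] with p h1 h2 h3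
    exact ⟨h1.le, h3.le, h2.le⟩
  apply tendsto_integral_filter_of_dominated_convergence
    (bound := fun x => 2 * (Real.exp (1/2) * Real.exp (-(1/8) * (x - m₀)^2)))
  · refine Eventually.of_forall fun p => ?_
    exact (((measurable_gaussianPDFReal _ _).sub (measurable_gaussianPDFReal _ _)).norm).aestronglyMeasurable
  · filter_upwards [hev] with p hp
    refine ae_of_all _ fun x => ?_
    have a1 := pdf_bound m₀ p hp.1 hp.2.1 hp.2.2 x
    have a2 := pdf_bound m₀ (m₀, 1) (by simp) (by norm_num) (by norm_num) x
    have a3 := gaussianPDFReal_nonneg p.1 p.2.toNNReal x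
    have a4 := gaussianPDFReal_nonneg m₀ 1 x
    simp only [Real.toNNReal_one] at a2
    rw [Real.norm_eq_abs, abs_abs, abs_le]
    constructor <;> linarith
  · have := (integrable_exp_neg_mul_sq (b := 1/8) (by norm_num)).comp_sub_right m₀
    exact (this.const_mul _).const_mul _
  · refine ae_of_all _ fun x => ?_
    have hc : ContinuousAt (fun p : ℝ × ℝ =>
        |gaussianPDFReal p.1 p.2.toNNReal x - gaussianPDFReal m₀ 1 x|) (m₀, 1) := by
      unfold gaussianPDFReal
      have hpi := Real.pi_pos
      have hh : ContinuousAt (fun p : ℝ × ℝ => ((p.2.toNNReal : NNReal) : ℝ)) (m₀, 1) := by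
        have : Continuous (fun p : ℝ × ℝ => ((p.2.toNNReal : NNReal) : ℝ)) := by fun_prop
        exact this.continuousAt
      have hs : √(2 * π * (((m₀, (1:ℝ)).2.toNNReal : NNReal) : ℝ)) ≠ 0 := by
        simp; positivity
      have hs2 : (2 * (((m₀, (1:ℝ)).2.toNNReal : NNReal) : ℝ)) ≠ 0 := by
        simp
      fun_prop (disch := assumption)
    have := hc.tendsto
    simpa using this

lemma tv_le (m m₀ : ℝ) {v v₀ : NNReal} (hv : v ≠ 0) (hv₀ : v₀ ≠ 0) (S : Set ℝ) :
    |(gaussianReal m v).real S - (gaussianReal m₀ v₀).real S|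
      ≤ ∫ x, |gaussianPDFReal m v x - gaussianPDFReal m₀ v₀ x| := by
  have h : ∀ m {v : NNReal}, v ≠ 0 → (gaussianReal m v).real S = ∫ x in S, gaussianPDFReal m v x := by
    intro m v hv
    rw [measureReal_def, gaussianReal_apply_eq_integral _ hv, ENNReal.toReal_ofReal]
    exact integral_nonneg fun x => gaussianPDFReal_nonneg _ _ _
  rw [h m hv, h m₀ hv₀, ← integral_sub (integrable_gaussianPDFReal _ _).integrableOn
    (integrable_gaussianPDFReal _ _).integrableOn]
  refine (abs_integral_le_integral_abs).trans ?_
  exact setIntegral_le_integral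
    ((integrable_gaussianPDFReal _ _).sub (integrable_gaussianPDFReal _ _)).abs
    (ae_of_all _ fun x => abs_nonneg _)

/-- the continuous function -/
noncomputable def Feps (δ : ℝ) (p : ℝ × ℝ) : ℝ :=
  epsDP (gaussianReal 0 1) (gaussianReal p.1 p.2.toNNReal) δ

lemma Feps_cont (m₀ : ℝ) {δ : ℝ} (hδ : 0 < δ) : ContinuousAt (Feps δ) (m₀, 1) := by
  have hδ2 : 0 < δ / 2 := by positivity
  obtain ⟨c1, hc1, H1⟩ := quant_ac (gaussianReal 0 1) (gaussianReal m₀ 1)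
    (gauss_ac _ _ one_ne_zero one_ne_zero) hδ2
  obtain ⟨c2, hc2, H2⟩ := quant_ac (gaussianReal m₀ 1) (gaussianReal 0 1)
    (gauss_ac _ _ one_ne_zero one_ne_zero) hδ2
  set c := min c1 c2 / 2 with hcdef
  have hc : 0 < c := by positivity
  have hcc1 : 2 * c ≤ c1 := by rw [hcdef]; linarith [min_le_left c1 c2]
  have hcc2 : 2 * c ≤ c2 := by rw [hcdef]; linarith [min_le_right c1 c2]
  rw [Metric.continuousAt_iff']
  intro η' hη'
  set η := η' / 2 with hηdef
  have hη : 0 < η := by positivity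
  set τ := min (δ / 4) (min c (c * (Real.exp η - 1))) with hτdef
  have hexp : 0 < Real.exp η - 1 := by
    have := Real.add_one_lt_exp hη.ne'; linarith
  have hτ : 0 < τ := by positivity
  have t1 : τ ≤ δ / 4 := min_le_left _ _
  have t2 : τ ≤ c := (min_le_right _ _).trans (min_le_left _ _)
  have t3 : τ ≤ c * (Real.exp η - 1) := (min_le_right _ _).trans (min_le_right _ _)
  have hexp2 : 1 + τ / c ≤ Real.exp η := by
    have : τ / c ≤ Real.exp η - 1 := by rw [div_le_iff₀ hc]; linarith
    linarith
  have ev1 := (tv_tendsto m₀).eventually (ge_mem_nhds hτ)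
  have ev2 : ∀ᶠ p : ℝ × ℝ in 𝓝 (m₀, 1), 0 < p.2 := by
    refine Filter.Tendsto.eventually_const_lt (f := fun p : ℝ × ℝ => p.2) ?_
      (Continuous.tendsto (by fun_prop) _)
    norm_num
  filter_upwards [ev1, ev2] with p hp hp2
  have hv : p.2.toNNReal ≠ 0 := by simpa using hp2
  have hTV : ∀ S, |(gaussianReal p.1 p.2.toNNReal).real S - (gaussianReal m₀ 1).real S| ≤ τ :=
    fun S => (tv_le _ _ hv one_ne_zero S).trans hp
  have g1 : ∀ S, MeasurableSet S → δ < (gaussianReal 0 1).real S → c ≤ (gaussianReal m₀ 1).real S :=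
    fun S hS h => by linarith [H1 S hS (by linarith)]
  have g2 : ∀ S, MeasurableSet S → δ < (gaussianReal m₀ 1).real S → c ≤ (gaussianReal 0 1).real S :=
    fun S hS h => by linarith [H2 S hS (by linarith)]
  have g3 : ∀ S, MeasurableSet S → δ < (gaussianReal 0 1).real S →
      c ≤ (gaussianReal p.1 p.2.toNNReal).real S :=
    fun S hS h => by linarith [H1 S hS (by linarith), (abs_le.1 (hTV S)).1]
  have g4 : ∀ S, MeasurableSet S → δ < (gaussianReal p.1 p.2.toNNReal).real S →
      c ≤ (gaussianReal 0 1).real S :=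
    fun S hS h => by linarith [H2 S hS (by linarith [(abs_le.1 (hTV S)).2])]
  have hb : ∀ Q : Measure ℝ, BddBelow {ε | Feas (gaussianReal 0 1) Q δ ε} :=
    fun Q => ⟨0, fun ε h => h.1⟩
  have A : Feps δ p ≤ Feps δ (m₀, 1) + η := by
    rw [← sub_le_iff_le_add]
    simp only [Feps, Real.toNNReal_one]
    rw [epsDP_eq _ (gaussianReal m₀ 1)]
    refine le_csInf (feas_exists _ _ hδ.le hc g1 g2) fun ε hε => ?_
    rw [sub_le_iff_le_add]
    refine csInf_le (hb _) ?_
    refine feas_shift _ (gaussianReal m₀ 1) _ hδ.le hc hτ.le hη.le hexp2 g3 g4 (fun S _ => ?_) hε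
    rw [abs_sub_comm]; exact hTV S
  have B : Feps δ (m₀, 1) ≤ Feps δ p + η := by
    rw [← sub_le_iff_le_add]
    simp only [Feps, Real.toNNReal_one]
    rw [epsDP_eq _ (gaussianReal p.1 p.2.toNNReal)]
    refine le_csInf (feas_exists _ _ hδ.le hc g3 g4) fun ε hε => ?_
    rw [sub_le_iff_le_add]
    refine csInf_le (hb _) ?_
    exact feas_shift _ (gaussianReal p.1 p.2.toNNReal) _ hδ.le hc hτ.le hη.le hexp2 g1 g2
      (fun S _ => hTV S) hε
  rw [Real.dist_eq]
  have : |Feps δ p - Feps δ (m₀, 1)| ≤ η := abs_le.2 ⟨by linarith, by linarith⟩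
  linarith

lemma epsDP_map (P Q : Measure ℝ) (δ : ℝ) (e : ℝ ≃ᵐ ℝ) :
    epsDP (P.map e) (Q.map e) δ = epsDP P Q δ := by
  unfold epsDP
  congr 1
  ext ε
  simp only [Set.mem_ofPred_eq, and_congr_right_iff]
  intro _
  constructor
  · intro h S hS
    have := h (e.symm ⁻¹' S) (e.symm.measurable hS)
    rw [e.map_apply, e.map_apply, ← Set.preimage_comp] at this
    simpa using this
  · intro h S hS
    rw [e.map_apply, e.map_apply]
    exact h _ (e.measurable hS)

lemma epsDP_scale (a : ℝ) (ha : a ≠ 0) (m₁ m₂ : ℝ) (v₁ v₂ : NNReal) (δ : ℝ) :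
    epsDP (gaussianReal m₁ v₁) (gaussianReal m₂ v₂) δ =
      epsDP (gaussianReal (a * m₁) (NNReal.mk (a^2) (sq_nonneg a) * v₁))
        (gaussianReal (a * m₂) (NNReal.mk (a^2) (sq_nonneg a) * v₂)) δ := by
  rw [← gaussianReal_map_const_mul, ← gaussianReal_map_const_mul,
    ← epsDP_map _ _ δ (Homeomorph.mulLeft₀ a ha).toMeasurableEquiv]
  rfl

lemma epsDP_est (d : ℕ) (hd : 1 ≤ d) (m v δ : ℝ) :
    epsDP (gaussianReal 0 ((d : NNReal))⁻¹) (gaussianReal m v.toNNReal) δ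
      = Feps δ (√d * m, d * v) := by
  have hd' : (0:ℝ) < d := by exact_mod_cast hd
  rw [epsDP_scale (√d) (by positivity), Feps]
  congr 2
  · simp
  · ext; simp [Real.sq_sqrt hd'.le, hd'.ne']
  · ext
    rw [Real.toNNReal_mul hd'.le]
    simp [Real.sq_sqrt hd'.le, hd'.ne']

lemma epsDP_true (σ : ℝ) (hσ : 0 < σ) (δ : ℝ) :
    epsDP (gaussianReal 0 (Real.toNNReal (σ ^ 2))) (gaussianReal 1 (Real.toNNReal (σ ^ 2))) δ
      = Feps δ (1 / σ, 1) := by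
  have hh : (NNReal.mk ((σ⁻¹)^2) (sq_nonneg σ⁻¹) * Real.toNNReal (σ ^ 2) : NNReal) = 1 := by
    ext; simp [hσ.ne', max_eq_left (sq_nonneg σ)]
  rw [epsDP_scale (σ⁻¹) (by positivity), Feps, hh]
  simp

section CPsec

variable {Ω : ℕ → Type*} [∀ d, MeasurableSpace (Ω d)]

/-- convergence in probability over varying spaces -/
def CP {E : Type*} [TopologicalSpace E] (P : ∀ d, Measure (Ω d)) (f : ∀ d, Ω d → E) (p : E) : Prop :=
  ∀ U ∈ 𝓝 p, Tendsto (fun d => P d {ω | f d ω ∉ U}) atTop (𝓝 0)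

variable {P : ∀ d, Measure (Ω d)} {E F : Type*} [TopologicalSpace E] [TopologicalSpace F]

lemma CP.prodMk {f : ∀ d, Ω d → E} {g : ∀ d, Ω d → F} {p : E} {q : F} (hf : CP P f p)
    (hg : CP P g q) : CP P (fun d ω => (f d ω, g d ω)) (p, q) := by
  intro U hU
  rw [nhds_prod_eq, Filter.mem_prod_iff] at hU
  obtain ⟨U1, h1, U2, h2, h⟩ := hU
  have := (hf U1 h1).add (hg U2 h2)
  rw [add_zero] at this
  refine tendsto_of_tendsto_of_tendsto_of_le_of_le tendsto_const_nhds this (fun _ => zero_le) ?_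
  intro d
  refine (measure_mono ?_).trans (measure_union_le _ _)
  intro ω hω
  by_contra hc
  simp only [Set.mem_union, Set.mem_ofPred_eq, not_or, not_not] at hc
  exact hω (h ⟨hc.1, hc.2⟩)

lemma CP.map {f : ∀ d, Ω d → E} {p : E} (hf : CP P f p) {G : E → F} (hG : ContinuousAt G p) :
    CP P (fun d ω => G (f d ω)) (G p) := fun U hU => hf (G ⁻¹' U) (hG hU)

lemma CP.congr {f g : ∀ d, Ω d → E} {p : E} (hf : CP P f p)
    (h : ∀ᶠ d in atTop, ∀ ω, f d ω = g d ω) : CP P g p := by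
  intro U hU
  refine (hf U hU).congr' ?_
  filter_upwards [h] with d hd
  simp [hd]

lemma CP.squeeze {f g : ∀ d, Ω d → ℝ} (hg : CP P g 0)
    (h : ∀ᶠ d in atTop, ∀ ω, |f d ω| ≤ g d ω) : CP P f 0 := by
  intro U hU
  obtain ⟨r, hr, hU⟩ := Metric.mem_nhds_iff.1 hU
  refine tendsto_of_tendsto_of_tendsto_of_le_of_le' tendsto_const_nhds
    (hg _ (Metric.ball_mem_nhds 0 hr)) (Eventually.of_forall fun _ => zero_le) ?_
  filter_upwards [h] with d hd
  refine measure_mono fun ω hω hc => hω (hU ?_)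
  simp only [Metric.mem_ball, dist_zero_right, Real.norm_eq_abs] at hc ⊢
  exact ((hd ω).trans (le_abs_self _)).trans_lt hc

lemma CP.const {a : ℕ → E} {p : E} (ha : Tendsto a atTop (𝓝 p)) : CP P (fun d _ => a d) p := by
  intro U hU
  refine tendsto_const_nhds.congr' ?_
  filter_upwards [ha.eventually hU] with d hd
  have hd : a d ∈ U := hd
  simp [hd]

lemma CP.of_lintegral {f : ∀ d, Ω d → ℝ} (hm : ∀ d, Measurable (f d)) (h0 : ∀ d ω, 0 ≤ f d ω)
    (h : Tendsto (fun d => ∫⁻ ω, ENNReal.ofReal (f d ω) ∂P d) atTop (𝓝 0)) : CP P f 0 := by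
  intro U hU
  obtain ⟨r, hr, hU⟩ := Metric.mem_nhds_iff.1 hU
  have hr' : ENNReal.ofReal r ≠ 0 := by simpa using hr
  have h2 : Tendsto (fun d => (∫⁻ ω, ENNReal.ofReal (f d ω) ∂P d) / ENNReal.ofReal r) atTop (𝓝 0) := by
    have := ENNReal.Tendsto.div_const h (b := ENNReal.ofReal r) (Or.inr hr')
    simpa using this
  refine tendsto_of_tendsto_of_tendsto_of_le_of_le tendsto_const_nhds h2 (fun _ => zero_le) ?_
  intro d
  refine le_trans (measure_mono ?_) (meas_ge_le_lintegral_div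
    (hm d).ennreal_ofReal.aemeasurable hr' ENNReal.ofReal_ne_top)
  intro ω hω
  by_contra hc
  simp only [Set.mem_ofPred_eq, not_le] at hc
  rw [ENNReal.ofReal_lt_ofReal_iff hr] at hc
  apply hω (hU _)
  simpa [abs_of_nonneg (h0 d ω)] using hc

lemma CP.of_sq {f : ∀ d, Ω d → ℝ} (hm : ∀ d, Measurable (f d))
    (h : Tendsto (fun d => ∫⁻ ω, ENNReal.ofReal ((f d ω)^2) ∂P d) atTop (𝓝 0)) : CP P f 0 := by
  have h1 : CP P (fun d ω => (f d ω)^2) 0 :=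
    CP.of_lintegral (fun d => (hm d).pow_const 2) (fun d ω => sq_nonneg _) h
  have h2 := h1.map (G := Real.sqrt) Real.continuous_sqrt.continuousAt
  rw [Real.sqrt_zero] at h2
  exact h2.squeeze (Eventually.of_forall fun d ω => by rw [Real.sqrt_sq_eq_abs])

end CPsec

section moments

lemma sum_sq_le {α : Type*} [MeasurableSpace α] (μ : Measure α) [IsProbabilityMeasure μ] (n : ℕ)
    (f : α → ℝ) (hf : MemLp f 2 μ) :
    ∫⁻ x, ENNReal.ofReal ((∑ i, f (x i) - n * ∫ a, f a ∂μ)^2) ∂(Measure.pi fun _ : Fin n => μ)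
      ≤ n * ∫⁻ a, ENNReal.ofReal ((f a)^2) ∂μ := by
  have hi : ∀ i : Fin n, MemLp (fun x : Fin n → α => f (x i)) 2 (Measure.pi fun _ : Fin n => μ) :=
    fun i => hf.comp_measurePreserving (measurePreserving_eval _ i)
  have hS : MemLp (∑ i, fun x : Fin n → α => f (x i)) 2 (Measure.pi fun _ : Fin n => μ) :=
    memLp_finsetSum' _ fun i _ => hi i
  have hE : (Measure.pi fun _ : Fin n => μ)[∑ i, fun x : Fin n → α => f (x i)] = n * ∫ a, f a ∂μ := by
    simp only [Finset.sum_apply]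
    rw [integral_finsetSum _ fun i _ => (hi i).integrable (by norm_num)]
    simp_rw [integral_comp_eval (μ := fun _ : Fin n => μ) hf.aestronglyMeasurable]
    simp
  have h1 := hS.ofReal_variance_eq
  rw [variance_sum_pi (fun _ => hf), evariance, hE] at h1
  have h2 : ENNReal.ofReal (Var[f; μ]) ≤ ∫⁻ a, ENNReal.ofReal ((f a)^2) ∂μ := by
    rw [← ofReal_integral_eq_lintegral_ofReal hf.integrable_sq (ae_of_all _ fun x => sq_nonneg _)]
    exact ENNReal.ofReal_le_ofReal (variance_le_expectation_sq hf.aestronglyMeasurable)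
  have h3 : ∫⁻ x, ENNReal.ofReal ((∑ i, f (x i) - n * ∫ a, f a ∂μ)^2)
      ∂(Measure.pi fun _ : Fin n => μ) = ENNReal.ofReal (∑ i : Fin n, Var[f; μ]) := by
    rw [h1]
    refine lintegral_congr fun x => ?_
    rw [← ofReal_norm, ← ENNReal.ofReal_pow (norm_nonneg _), Real.norm_eq_abs, sq_abs]
    simp
  rw [h3, Finset.sum_const, Finset.card_univ, Fintype.card_fin, nsmul_eq_mul,
    ENNReal.ofReal_mul (by positivity), ENNReal.ofReal_natCast]
  gcongr

lemma avg_sq_le {α : Type*} [MeasurableSpace α] (μ : Measure α) [IsProbabilityMeasure μ] (n : ℕ)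
    (hn : 1 ≤ n) (f : α → ℝ) (hf : MemLp f 2 μ) :
    ∫⁻ x, ENNReal.ofReal (((1 / n : ℝ) * ∑ i, f (x i) - ∫ a, f a ∂μ)^2)
        ∂(Measure.pi fun _ : Fin n => μ)
      ≤ ENNReal.ofReal (1 / n) * ∫⁻ a, ENNReal.ofReal ((f a)^2) ∂μ := by
  have hn' : (0:ℝ) < n := by exact_mod_cast hn
  have h := sum_sq_le μ n f hf
  calc _ = ∫⁻ x, ENNReal.ofReal ((1 / n : ℝ)^2) *
        ENNReal.ofReal ((∑ i, f (x i) - n * ∫ a, f a ∂μ)^2) ∂(Measure.pi fun _ : Fin n => μ) := by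
        refine lintegral_congr fun x => ?_
        rw [← ENNReal.ofReal_mul (by positivity)]
        congr 1
        field_simp
    _ = ENNReal.ofReal ((1 / n : ℝ)^2) * ∫⁻ x,
        ENNReal.ofReal ((∑ i, f (x i) - n * ∫ a, f a ∂μ)^2) ∂(Measure.pi fun _ : Fin n => μ) := by
        rw [lintegral_const_mul' _ _ ENNReal.ofReal_ne_top]
    _ ≤ ENNReal.ofReal ((1 / n : ℝ)^2) * (n * ∫⁻ a, ENNReal.ofReal ((f a)^2) ∂μ) := by gcongr
    _ = _ := by
        rw [← mul_assoc, ← ENNReal.ofReal_natCast, ← ENNReal.ofReal_mul (by positivity)]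
        congr 2
        field_simp

lemma stdG_eq (d : ℕ) : stdGaussianE d = stdGaussian (EuclideanSpace ℝ (Fin d)) :=
  map_pi_eq_stdGaussian

instance stdG_prob (d : ℕ) : IsProbabilityMeasure (stdGaussianE d) := by
  rw [stdG_eq]; infer_instance

lemma stdG_inner (d : ℕ) (c : EuclideanSpace ℝ (Fin d)) (hc : ‖c‖ = 1) (f : ℝ → ℝ≥0∞)
    (hf : Measurable f) :
    ∫⁻ z, f ⟪c, z⟫_ℝ ∂(stdGaussianE d) = ∫⁻ x, f x ∂(gaussianReal 0 1) := by
  rw [stdG_eq]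
  have h := IsGaussian.map_eq_gaussianReal (μ := stdGaussian (EuclideanSpace ℝ (Fin d)))
    (innerSL ℝ c)
  rw [variance_dual_stdGaussian, integral_strongDual_stdGaussian, innerSL_apply_norm, hc] at h
  simp only [one_pow, Real.toNNReal_one] at h
  rw [← h, lintegral_map hf (by fun_prop)]
  rfl

lemma gauss_pow_fin (p : ℕ) (hp : Even p) : ∫⁻ x, ENNReal.ofReal (x^p) ∂(gaussianReal 0 1) ≠ ∞ := by
  have h : Integrable (fun x : ℝ => x^p) (gaussianReal 0 1) := by
    have := (memLp_id_gaussianReal (μ := 0) (v := 1) p).integrable_norm_pow'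
    simp only [id] at this
    refine this.congr (ae_of_all _ fun x => ?_)
    simp [hp.pow_abs]
  rw [← ofReal_integral_eq_lintegral_ofReal h (ae_of_all _ fun x => hp.pow_nonneg x)]
  exact ENNReal.ofReal_ne_top

lemma gauss_norm (d : ℕ) (hd : 1 ≤ d) :
    ∫⁻ z, ENNReal.ofReal ((‖z‖^2 / d - 1)^2) ∂(stdGaussianE d) ≤
      ENNReal.ofReal (1 / d) * ∫⁻ x, ENNReal.ofReal (x^4) ∂(gaussianReal 0 1) := by
  have hm : MemLp (fun x : ℝ => x^2) 2 (gaussianReal 0 1) := by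
    have := (memLp_id_gaussianReal (μ := 0) (v := 1) 4)
    rw [memLp_two_iff_integrable_sq (by fun_prop)]
    have := this.integrable_norm_pow'
    simp only [id] at this
    refine this.congr (ae_of_all _ fun x => ?_)
    show ‖x‖ ^ 4 = (x ^ 2) ^ 2
    rw [← pow_mul, Real.norm_eq_abs]
    exact (by decide : Even 4).pow_abs x
  have h1 : ∫ x, x^2 ∂(gaussianReal 0 1) = 1 := by
    have := variance_id_gaussianReal (μ := 0) (v := 1)
    rw [variance_eq_integral (by fun_prop)] at this
    simpa using this
  have h := avg_sq_le (gaussianReal 0 1) d hd _ hm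
  rw [h1] at h
  rw [stdGaussianE, lintegral_map (by fun_prop) (by fun_prop)]
  refine le_trans (le_of_eq ?_) (h.trans (le_of_eq ?_))
  · refine lintegral_congr fun x => ?_
    rw [EuclideanSpace.real_norm_sq_eq]
    congr 3
    simp [div_eq_inv_mul]
  · congr 1
    refine lintegral_congr fun x => ?_
    ring_nf

variable {d : ℕ} {μ : Measure (EuclideanSpace ℝ (Fin d))} [IsProbabilityMeasure μ]

/-- uniform on sphere -/
def IsUnif (μ : Measure (EuclideanSpace ℝ (Fin d))) : Prop :=
  (∀ᵐ c ∂μ, ‖c‖ = 1) ∧ ∀ O : EuclideanSpace ℝ (Fin d) ≃ₗᵢ[ℝ] EuclideanSpace ℝ (Fin d), μ.map O = μ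

lemma IsUnif.memLp (h : IsUnif μ) (z : EuclideanSpace ℝ (Fin d)) (p : ℝ≥0∞) :
    MemLp (fun c => ⟪c, z⟫_ℝ) p μ := by
  refine MemLp.of_bound (by fun_prop) ‖z‖ ?_
  filter_upwards [h.1] with c hc
  have := norm_inner_le_norm (𝕜 := ℝ) c z
  rwa [hc, one_mul] at this

lemma IsUnif.memLp2 (h : IsUnif μ) (z : EuclideanSpace ℝ (Fin d)) (p : ℝ≥0∞) :
    MemLp (fun c => ⟪c, z⟫_ℝ ^ 2) p μ := by
  refine MemLp.of_bound (by fun_prop) (‖z‖^2) ?_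
  filter_upwards [h.1] with c hc
  have := norm_inner_le_norm (𝕜 := ℝ) c z
  rw [hc, one_mul] at this
  rw [norm_pow]
  gcongr

lemma IsUnif.integral_inner (h : IsUnif μ) (z : EuclideanSpace ℝ (Fin d)) :
    ∫ c, ⟪c, z⟫_ℝ ∂μ = 0 := by
  have h1 := h.2 (LinearIsometryEquiv.neg ℝ)
  have h2 : ∫ c, ⟪c, z⟫_ℝ ∂μ = - ∫ c, ⟪c, z⟫_ℝ ∂μ := by
    conv_lhs => rw [← h1]
    rw [integral_map (by fun_prop) (by fun_prop)]
    simp [integral_neg]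
  linarith

lemma IsUnif.integral_sq_congr (h : IsUnif μ) (z w : EuclideanSpace ℝ (Fin d)) (hzw : ‖z‖ = ‖w‖) :
    ∫ c, ⟪c, z⟫_ℝ^2 ∂μ = ∫ c, ⟪c, w⟫_ℝ^2 ∂μ := by
  set O := Submodule.reflection (ℝ ∙ (z - w))ᗮ
  have hO : O z = w := Submodule.reflection_sub hzw
  conv_rhs => rw [← h.2 O]
  rw [integral_map (by fun_prop) (by fun_prop)]
  simp_rw [← hO, LinearIsometryEquiv.inner_map_map]

lemma IsUnif.integral_sq (h : IsUnif μ) (hd : 1 ≤ d) (z : EuclideanSpace ℝ (Fin d)) :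
    ∫ c, ⟪c, z⟫_ℝ^2 ∂μ = ‖z‖^2 / d := by
  have hd' : (0:ℝ) < d := by exact_mod_cast hd
  have h1 : ∀ j : Fin d, ∫ c, ⟪c, z⟫_ℝ^2 ∂μ = ‖z‖^2 * ∫ c : EuclideanSpace ℝ (Fin d), (c j)^2 ∂μ := by
    intro j
    rw [h.integral_sq_congr z (‖z‖ • EuclideanSpace.single j (1:ℝ)) (by simp [norm_smul]),
      ← integral_const_mul]
    refine integral_congr_ae (ae_of_all _ fun c => ?_)
    simp [real_inner_smul_right, EuclideanSpace.inner_single_right, mul_pow]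
  have h2 : ∑ j : Fin d, ∫ c : EuclideanSpace ℝ (Fin d), (c j)^2 ∂μ = 1 := by
    rw [← integral_finsetSum]
    · have : ∫ c : EuclideanSpace ℝ (Fin d), (1:ℝ) ∂μ = 1 := by simp
      rw [← this]
      refine integral_congr_ae ?_
      filter_upwards [h.1] with c hc
      rw [← EuclideanSpace.real_norm_sq_eq, hc, one_pow]
    · intro j _
      have := (h.memLp2 (EuclideanSpace.single j (1:ℝ)) 1).integrable le_rfl
      refine this.congr (ae_of_all _ fun c => ?_)
      simp [EuclideanSpace.inner_single_right]
  have h3 : (d:ℝ) * ∫ c, ⟪c, z⟫_ℝ^2 ∂μ = ‖z‖^2 := by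
    calc (d:ℝ) * ∫ c, ⟪c, z⟫_ℝ^2 ∂μ = ∑ j : Fin d, ∫ c, ⟪c, z⟫_ℝ^2 ∂μ := by simp
      _ = ∑ j : Fin d, ‖z‖^2 * ∫ c : EuclideanSpace ℝ (Fin d), (c j)^2 ∂μ :=
        Finset.sum_congr rfl fun j _ => h1 j
      _ = _ := by rw [← Finset.mul_sum, h2, mul_one]
  field_simp
  linarith

lemma IsUnif.lintegral_sq (h : IsUnif μ) (hd : 1 ≤ d) (z : EuclideanSpace ℝ (Fin d)) :
    ∫⁻ c, ENNReal.ofReal (⟪c, z⟫_ℝ^2) ∂μ = ENNReal.ofReal (‖z‖^2 / d) := by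
  rw [← h.integral_sq hd, ofReal_integral_eq_lintegral_ofReal
    ((h.memLp2 z 1).integrable le_rfl) (ae_of_all _ fun x => sq_nonneg _)]

lemma IsUnif.lintegral_sum (h : IsUnif μ) (hd : 1 ≤ d) (n : ℕ) :
    ∫⁻ c : Fin n → EuclideanSpace ℝ (Fin d), ENNReal.ofReal (‖∑ i, c i‖^2)
      ∂(Measure.pi fun _ : Fin n => μ) ≤ n := by
  have hd' : (0:ℝ) < d := by exact_mod_cast hd
  have h1 : ∀ c : Fin n → EuclideanSpace ℝ (Fin d), ENNReal.ofReal (‖∑ i, c i‖^2) =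
      ∑ j : Fin d, ENNReal.ofReal ((∑ i, ⟪c i, EuclideanSpace.single j (1:ℝ)⟫_ℝ)^2) := by
    intro c
    rw [← ENNReal.ofReal_sum_of_nonneg (fun _ _ => sq_nonneg _), EuclideanSpace.real_norm_sq_eq]
    simp [EuclideanSpace.inner_single_right]
  simp_rw [h1]
  rw [lintegral_finsetSum _ (by fun_prop)]
  have h2 : ∀ j : Fin d, ∫⁻ c : Fin n → EuclideanSpace ℝ (Fin d),
      ENNReal.ofReal ((∑ i, ⟪c i, EuclideanSpace.single j (1:ℝ)⟫_ℝ)^2)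
      ∂(Measure.pi fun _ : Fin n => μ) ≤ n * ENNReal.ofReal (1 / d) := by
    intro j
    have := sum_sq_le μ n _ (h.memLp (EuclideanSpace.single j (1:ℝ)) 2)
    rw [h.integral_inner, h.lintegral_sq hd] at this
    simpa using this
  refine (Finset.sum_le_sum fun j _ => h2 j).trans ?_
  rw [Finset.sum_const, Finset.card_univ, Fintype.card_fin, nsmul_eq_mul, mul_left_comm,
    ← ENNReal.ofReal_natCast d, ← ENNReal.ofReal_mul hd'.le]
  rw [mul_one_div_cancel hd'.ne']
  simp

lemma IsUnif.lintegral_b (h : IsUnif μ) (hd : 1 ≤ d) (n : ℕ) (X : EuclideanSpace ℝ (Fin d))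
    (i : Fin n) :
    ∫⁻ c : Fin n → EuclideanSpace ℝ (Fin d), ENNReal.ofReal ((⟪c i, X + ∑ j, c j⟫_ℝ - 1)^2)
      ∂(Measure.pi fun _ : Fin n => μ) ≤ ENNReal.ofReal ((2 * ‖X‖^2 + 2 * n) / d) := by
  have hd' : (0:ℝ) < d := by exact_mod_cast hd
  obtain ⟨n, rfl⟩ : ∃ m, n = m + 1 := ⟨n - 1, by have := i.2; omega⟩
  have hmp := measurePreserving_piFinSuccAbove (fun _ : Fin (n+1) => μ) i
  have e1 : ∀ c : Fin (n+1) → EuclideanSpace ℝ (Fin d),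
      ENNReal.ofReal ((⟪c i, X + ∑ j, c j⟫_ℝ - 1)^2) =
      (fun p : EuclideanSpace ℝ (Fin d) × (Fin n → EuclideanSpace ℝ (Fin d)) =>
        ENNReal.ofReal ((⟪p.1, X + (p.1 + ∑ j, p.2 j)⟫_ℝ - 1)^2))
        (MeasurableEquiv.piFinSuccAbove (fun _ : Fin (n+1) => EuclideanSpace ℝ (Fin d)) i c) := by
    intro c
    rw [Fin.sum_univ_succAbove _ i]
    rfl
  have e3 := hmp.lintegral_comp
    (f := fun p : EuclideanSpace ℝ (Fin d) × (Fin n → EuclideanSpace ℝ (Fin d)) =>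
        ENNReal.ofReal ((⟪p.1, X + (p.1 + ∑ j, p.2 j)⟫_ℝ - 1)^2)) (by fun_prop)
  refine ((lintegral_congr e1).trans e3).trans_le ?_
  rw [lintegral_prod_symm' _ (by fun_prop)]
  have e2 : ∀ y : Fin n → EuclideanSpace ℝ (Fin d),
      ∫⁻ c, ENNReal.ofReal ((⟪c, X + (c + ∑ j, y j)⟫_ℝ - 1)^2) ∂μ
        ≤ ENNReal.ofReal (2 / d * ‖X‖^2) + ENNReal.ofReal (2 / d) * ENNReal.ofReal (‖∑ j, y j‖^2) := by
    intro y
    have : ∫⁻ c, ENNReal.ofReal ((⟪c, X + (c + ∑ j, y j)⟫_ℝ - 1)^2) ∂μ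
        = ∫⁻ c, ENNReal.ofReal (⟪c, X + ∑ j, y j⟫_ℝ^2) ∂μ := by
      refine lintegral_congr_ae ?_
      filter_upwards [h.1] with c hc
      rw [show X + (c + ∑ j, y j) = c + (X + ∑ j, y j) by abel, inner_add_right,
        real_inner_self_eq_norm_sq, hc]
      congr 2
      ring
    rw [this, h.lintegral_sq hd, ← ENNReal.ofReal_mul (by positivity),
      ← ENNReal.ofReal_add (by positivity) (by positivity)]
    apply ENNReal.ofReal_le_ofReal
    rw [div_le_iff₀ hd']
    have h5 : ‖X + ∑ j, y j‖ ^ 2 ≤ (‖X‖ + ‖∑ j, y j‖)^2 := by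
      gcongr
      exact norm_add_le _ _
    have h6 : (2 / d * ‖X‖^2 + 2 / d * ‖∑ j, y j‖^2) * (d:ℝ) = 2 * ‖X‖^2 + 2 * ‖∑ j, y j‖^2 := by
      field_simp
    rw [h6]
    nlinarith [sq_nonneg (‖X‖ - ‖∑ j, y j‖)]
  refine (lintegral_mono e2).trans ?_
  rw [lintegral_add_left (by fun_prop), lintegral_const_mul' _ _ ENNReal.ofReal_ne_top]
  have h7 := h.lintegral_sum hd n
  calc _ ≤ ENNReal.ofReal (2 / d * ‖X‖^2) + ENNReal.ofReal (2 / d) * (n : ℝ≥0∞) := by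
        gcongr
        simp
    _ ≤ _ := by
        rw [← ENNReal.ofReal_natCast n, ← ENNReal.ofReal_mul (by positivity),
          ← ENNReal.ofReal_add (by positivity) (by positivity)]
        apply ENNReal.ofReal_le_ofReal
        rw [le_div_iff₀ hd']
        have h6 : (2 / d * ‖X‖^2 + 2 / d * n) * (d:ℝ) = 2 * ‖X‖^2 + 2 * n := by
          field_simp
        rw [h6]
        push_cast
        linarith

end moments

section canary

variable {d : ℕ} {μ : Measure (EuclideanSpace ℝ (Fin d))} [IsProbabilityMeasure μ]

instance canary_prob (n : ℕ) : IsProbabilityMeasure (canaryP d n μ) := by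
  unfold canaryP; infer_instance

lemma canary_fst (n : ℕ) (f : (Fin n → EuclideanSpace ℝ (Fin d)) → ℝ≥0∞) (hf : Measurable f) :
    ∫⁻ ω, f ω.1 ∂(canaryP d n μ) = ∫⁻ c, f c ∂(Measure.pi fun _ : Fin n => μ) := by
  rw [canaryP, lintegral_prod _ (by fun_prop)]
  simp

lemma canary_snd (n : ℕ) (f : (EuclideanSpace ℝ (Fin d)) → ℝ≥0∞) (hf : Measurable f) :
    ∫⁻ ω, f ω.2 ∂(canaryP d n μ) = ∫⁻ c, f c ∂(stdGaussianE d) := by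
  rw [canaryP, lintegral_prod_symm _ (by fun_prop)]
  simp

lemma P_L (h : IsUnif μ) (hd : 1 ≤ d) (n : ℕ) :
    ∫⁻ ω, ENNReal.ofReal (‖∑ i, ω.1 i‖^2 / d) ∂(canaryP d n μ) ≤ ENNReal.ofReal (n / d) := by
  have hd' : (0:ℝ) < d := by exact_mod_cast hd
  rw [canary_fst n (fun c => ENNReal.ofReal (‖∑ i, c i‖^2 / d)) (by fun_prop)]
  simp_rw [div_eq_mul_inv, ENNReal.ofReal_mul' (inv_nonneg.2 hd'.le)]
  rw [lintegral_mul_const' _ _ ENNReal.ofReal_ne_top, ENNReal.ofReal_natCast]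
  gcongr
  exact h.lintegral_sum hd n

lemma P_R (h : IsUnif μ) (hd : 1 ≤ d) (n : ℕ) (hn : 1 ≤ n) (X : EuclideanSpace ℝ (Fin d)) :
    ∫⁻ ω, ENNReal.ofReal ((1 / n : ℝ) * ∑ i, (⟪ω.1 i, X + ∑ j, ω.1 j⟫_ℝ - 1)^2) ∂(canaryP d n μ)
      ≤ ENNReal.ofReal ((2 * ‖X‖^2 + 2 * n) / d) := by
  have hn' : (0:ℝ) < n := by exact_mod_cast hn
  rw [canary_fst n (fun c => ENNReal.ofReal
    ((1 / n : ℝ) * ∑ i, (⟪c i, X + ∑ j, c j⟫_ℝ - 1)^2)) (by fun_prop)]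
  simp_rw [ENNReal.ofReal_mul (by positivity : (0:ℝ) ≤ 1 / n),
    ENNReal.ofReal_sum_of_nonneg (fun _ _ => sq_nonneg _)]
  rw [lintegral_const_mul' _ _ ENNReal.ofReal_ne_top, lintegral_finsetSum _ (by fun_prop)]
  calc _ ≤ ENNReal.ofReal (1 / n) * ∑ i : Fin n, ENNReal.ofReal ((2 * ‖X‖^2 + 2 * n) / d) := by
        gcongr with i
        exact h.lintegral_b hd n X i
    _ = _ := by
        rw [Finset.sum_const, Finset.card_univ, Fintype.card_fin, nsmul_eq_mul, ← mul_assoc,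
          ← ENNReal.ofReal_natCast n, ← ENNReal.ofReal_mul (by positivity),
          one_div_mul_cancel hn'.ne', ENNReal.ofReal_one, one_mul]

lemma P_A (hd : 1 ≤ d) (n : ℕ) :
    ∫⁻ ω, ENNReal.ofReal ((‖ω.2‖^2 / d - 1)^2) ∂(canaryP d n μ) ≤
      ENNReal.ofReal (1 / d) * ∫⁻ x, ENNReal.ofReal (x^4) ∂(gaussianReal 0 1) := by
  rw [canary_snd n (fun z => ENNReal.ofReal ((‖z‖^2 / d - 1)^2)) (by fun_prop)]
  exact gauss_norm d hd

lemma swap_pow (h : IsUnif μ) (p : ℕ) :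
    ∫⁻ z, ∫⁻ c, ENNReal.ofReal (⟪c, z⟫_ℝ^p) ∂μ ∂(stdGaussianE d)
      = ∫⁻ x, ENNReal.ofReal (x^p) ∂(gaussianReal 0 1) := by
  rw [lintegral_lintegral_swap (by fun_prop)]
  have : ∀ᵐ c ∂μ, ∫⁻ z, ENNReal.ofReal (⟪c, z⟫_ℝ^p) ∂(stdGaussianE d)
      = ∫⁻ x, ENNReal.ofReal (x^p) ∂(gaussianReal 0 1) := by
    filter_upwards [h.1] with c hc
    exact stdG_inner d c hc (fun x => ENNReal.ofReal (x^p)) (by fun_prop)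
  rw [lintegral_congr_ae this]
  simp

lemma P_B (h : IsUnif μ) (n : ℕ) (hn : 1 ≤ n) :
    ∫⁻ ω, ENNReal.ofReal (((1 / n : ℝ) * ∑ i, ⟪ω.1 i, ω.2⟫_ℝ)^2) ∂(canaryP d n μ)
      ≤ ENNReal.ofReal (1 / n) * ∫⁻ x, ENNReal.ofReal (x^2) ∂(gaussianReal 0 1) := by
  rw [canaryP, lintegral_prod_symm _ (by fun_prop), ← swap_pow h,
    ← lintegral_const_mul' _ _ ENNReal.ofReal_ne_top]
  refine lintegral_mono fun z => ?_
  have := avg_sq_le μ n hn _ (h.memLp z 2)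
  rw [h.integral_inner] at this
  simpa using this

lemma P_W (h : IsUnif μ) (hd : 1 ≤ d) (n : ℕ) (hn : 1 ≤ n) :
    ∫⁻ ω, ENNReal.ofReal (((1 / n : ℝ) * ∑ i, ⟪ω.1 i, ω.2⟫_ℝ^2 - ‖ω.2‖^2 / d)^2) ∂(canaryP d n μ)
      ≤ ENNReal.ofReal (1 / n) * ∫⁻ x, ENNReal.ofReal (x^4) ∂(gaussianReal 0 1) := by
  rw [canaryP, lintegral_prod_symm _ (by fun_prop), ← swap_pow h,
    ← lintegral_const_mul' _ _ ENNReal.ofReal_ne_top]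
  refine lintegral_mono fun z => ?_
  have := avg_sq_le μ n hn _ (h.memLp2 z 2)
  rw [h.integral_sq hd] at this
  refine this.trans (le_of_eq ?_)
  simp_rw [← pow_mul]

end canary

lemma avg_abs_le {n : ℕ} (u v : Fin n → ℝ) :
    |(1 / n : ℝ) * ∑ i, u i * v i| ≤ √((1 / n : ℝ) * ∑ i, u i ^ 2) * √((1 / n : ℝ) * ∑ i, v i ^ 2) := by
  rw [← Real.sqrt_mul (by positivity)]
  apply Real.abs_le_sqrt
  have := Finset.sum_mul_sq_le_sq_mul_sq Finset.univ u v
  calc _ = (1 / n : ℝ)^2 * (∑ i, u i * v i)^2 := by ring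
    _ ≤ (1 / n : ℝ)^2 * ((∑ i, u i ^ 2) * ∑ i, v i ^ 2) := by gcongr
    _ = _ := by ring

lemma avg_abs_le' {n : ℕ} (hn : 1 ≤ n) (v : Fin n → ℝ) :
    |(1 / n : ℝ) * ∑ i, v i| ≤ √((1 / n : ℝ) * ∑ i, v i ^ 2) := by
  have hn' : (n:ℝ) ≠ 0 := by positivity
  have := avg_abs_le (fun _ => 1) v
  simpa [hn'] using this

lemma muHat_scale (d n : ℕ) (X : EuclideanSpace ℝ (Fin d)) (σ : ℝ)
    (ω : (Fin n → EuclideanSpace ℝ (Fin d)) × EuclideanSpace ℝ (Fin d)) :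
    √d * muHat d n X σ ω = ((1 / n : ℝ) * ∑ i, ⟪ω.1 i, rhoF d n X σ ω⟫_ℝ)
      / (‖rhoF d n X σ ω‖ / √d) := by
  unfold muHat cosStat
  rw [← Finset.sum_div, div_div_eq_mul_div]
  ring

lemma sigma_scale (d n : ℕ) (hn : 1 ≤ n) (X : EuclideanSpace ℝ (Fin d)) (σ : ℝ)
    (ω : (Fin n → EuclideanSpace ℝ (Fin d)) × EuclideanSpace ℝ (Fin d)) :
    d * sigmaHatSq d n X σ ω = ((1 / n : ℝ) * ∑ i, ⟪ω.1 i, rhoF d n X σ ω⟫_ℝ^2)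
      / (‖rhoF d n X σ ω‖ / √d)^2 - (√d * muHat d n X σ ω)^2 := by
  have hn' : (n:ℝ) ≠ 0 := by positivity
  have h1 : sigmaHatSq d n X σ ω = (1 / n : ℝ) * ∑ i, cosStat d n X σ ω i ^ 2 - muHat d n X σ ω ^ 2 := by
    unfold sigmaHatSq
    have e : ∀ m : ℝ, ∑ i, (cosStat d n X σ ω i - m)^2 =
        ∑ i, cosStat d n X σ ω i ^ 2 - 2 * m * ∑ i, cosStat d n X σ ω i + n * m^2 := by
      intro m
      simp_rw [sub_sq, Finset.sum_add_distrib, Finset.sum_sub_distrib, Finset.mul_sum]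
      simp
      refine Finset.sum_congr rfl fun i _ => by ring
    rw [e]
    have : ∑ i, cosStat d n X σ ω i = n * muHat d n X σ ω := by
      unfold muHat; field_simp
    rw [this]
    field_simp
    ring
  rw [h1, mul_sub, mul_pow, Real.sq_sqrt (by positivity)]
  congr 1
  unfold cosStat
  simp_rw [div_pow]
  rw [← Finset.sum_div, Real.sq_sqrt (by positivity), div_div_eq_mul_div]
  ring

/-- Under the asymptotic one-shot random-canary setup, for any
`δ ∈ (0,1)`, the estimate `ε̂_d = ε(N(0, 1/d) ‖ N(μ̂_d, σ̂_d²); δ)` produced by the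
one-shot privacy-estimation algorithm converges in probability, as `d → ∞`, to the
constant `ε(N(0, σ²) ‖ N(1, σ²); δ)`, the true privacy parameter of the Gaussian
mechanism with noise standard deviation `σ` and sensitivity `1`. -/
theorem one_shot_estimate_tendsto_true_epsilon
    (X : ∀ d : ℕ, EuclideanSpace ℝ (Fin d))
    (hX : (fun d : ℕ => ‖X d‖) =o[atTop] fun d : ℕ => Real.sqrt d)
    (k : ℕ → ℕ)
    (hk₁ : Tendsto (fun d : ℕ => (k d : ℝ)) atTop atTop)
    (hk₂ : Tendsto (fun d : ℕ => (k d : ℝ) / d) atTop (𝓝 0))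
    (σ : ℝ) (hσ : 0 < σ)
    (μs : ∀ d : ℕ, Measure (EuclideanSpace ℝ (Fin d)))
    (hprob : ∀ d, 1 ≤ d → IsProbabilityMeasure (μs d))
    (hsphere : ∀ d, 1 ≤ d → μs d (Metric.sphere (0 : EuclideanSpace ℝ (Fin d)) 1) = 1)
    (hinv : ∀ d, 1 ≤ d →
      ∀ O : EuclideanSpace ℝ (Fin d) ≃ₗᵢ[ℝ] EuclideanSpace ℝ (Fin d),
        (μs d).map O = μs d)
    (δ : ℝ) (hδ₀ : 0 < δ) (hδ₁ : δ < 1) :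
    ∀ ε : ℝ, 0 < ε →
      Tendsto (fun d : ℕ =>
          canaryP d (k d) (μs d)
            {ω | ε ≤ |epsDP (gaussianReal 0 ((d : NNReal))⁻¹)
                (gaussianReal (muHat d (k d) (X d) σ ω)
                  (Real.toNNReal (sigmaHatSq d (k d) (X d) σ ω))) δ -
              epsDP (gaussianReal 0 (Real.toNNReal (σ ^ 2)))
                (gaussianReal 1 (Real.toNNReal (σ ^ 2))) δ|})
        atTop (𝓝 0) := by
  have hd1 : ∀ᶠ d : ℕ in atTop, 1 ≤ d := eventually_ge_atTop 1
  have hkn : ∀ᶠ d : ℕ in atTop, 1 ≤ k d := by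
    filter_upwards [hk₁.eventually_ge_atTop 1] with d hd
    exact_mod_cast hd
  have hU : ∀ d, 1 ≤ d → IsUnif (μs d) := by
    intro d hd
    refine ⟨?_, hinv d hd⟩
    have := hprob d hd
    have h := hsphere d hd
    have : ∀ᵐ c ∂(μs d), c ∈ Metric.sphere (0 : EuclideanSpace ℝ (Fin d)) 1 := by
      rw [ae_mem_iff_measure_eq Metric.isClosed_sphere.measurableSet.nullMeasurableSet, h]
      simp
    filter_upwards [this] with c hc
    simpa using hc
  set P := fun d => canaryP d (k d) (μs d) with hP
  have hdinf : Tendsto (fun d : ℕ => (d:ℝ)) atTop atTop := tendsto_natCast_atTop_atTop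
  have lim_inv : ∀ (a : ℕ → ℝ) (C : ℝ≥0∞), C ≠ ∞ → Tendsto a atTop atTop →
      Tendsto (fun d => ENNReal.ofReal (1 / a d) * C) atTop (𝓝 0) := by
    intro a C hC ha
    have h1 : Tendsto (fun d => 1 / a d) atTop (𝓝 0) := by
      simpa [Function.comp_def] using tendsto_inv_atTop_zero.comp ha
    have h2 := ENNReal.tendsto_ofReal h1
    have h3 := ENNReal.Tendsto.mul_const h2 (b := C) (Or.inr hC)
    simpa using h3
  have hX2 : Tendsto (fun d : ℕ => ‖X d‖ / √d) atTop (𝓝 0) := hX.tendsto_div_nhds_zero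
  -- basic limits
  have cA : CP P (fun d ω => ‖ω.2‖^2 / d - 1) 0 := by
    refine CP.of_sq (fun d => by fun_prop) ?_
    refine tendsto_of_tendsto_of_tendsto_of_le_of_le' tendsto_const_nhds
      (lim_inv _ _ (gauss_pow_fin 4 (by decide)) hdinf) (Eventually.of_forall fun _ => zero_le) ?_
    filter_upwards [hd1] with d hd
    have := hprob d hd
    exact P_A hd _
  have cB : CP P (fun d ω => (1 / (k d) : ℝ) * ∑ i, ⟪ω.1 i, ω.2⟫_ℝ) 0 := by
    refine CP.of_sq (fun d => by fun_prop) ?_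
    refine tendsto_of_tendsto_of_tendsto_of_le_of_le' tendsto_const_nhds
      (lim_inv _ _ (gauss_pow_fin 2 (by decide)) hk₁) (Eventually.of_forall fun _ => zero_le) ?_
    filter_upwards [hd1, hkn] with d hd hn
    have := hprob d hd
    exact P_B (hU d hd) _ hn
  have cW : CP P (fun d ω => (1 / (k d) : ℝ) * ∑ i, ⟪ω.1 i, ω.2⟫_ℝ^2 - ‖ω.2‖^2 / d) 0 := by
    refine CP.of_sq (fun d => by fun_prop) ?_
    refine tendsto_of_tendsto_of_tendsto_of_le_of_le' tendsto_const_nhds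
      (lim_inv _ _ (gauss_pow_fin 4 (by decide)) hk₁) (Eventually.of_forall fun _ => zero_le) ?_
    filter_upwards [hd1, hkn] with d hd hn
    have := hprob d hd
    exact P_W (hU d hd) hd _ hn
  have cL : CP P (fun d ω => ‖∑ i, ω.1 i‖^2 / d) 0 := by
    refine CP.of_lintegral (fun d => by fun_prop) (fun d ω => by positivity) ?_
    have h2 := ENNReal.tendsto_ofReal hk₂
    rw [ENNReal.ofReal_zero] at h2
    refine tendsto_of_tendsto_of_tendsto_of_le_of_le' tendsto_const_nhds
      h2 (Eventually.of_forall fun _ => zero_le) ?_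
    filter_upwards [hd1] with d hd
    have := hprob d hd
    exact P_L (hU d hd) hd _
  have cR : CP P (fun d ω => (1 / (k d) : ℝ) *
      ∑ i, (⟪ω.1 i, X d + ∑ j, ω.1 j⟫_ℝ - 1)^2) 0 := by
    refine CP.of_lintegral (fun d => by fun_prop) (fun d ω => by positivity) ?_
    have h1 : Tendsto (fun d : ℕ => (2 * ‖X d‖^2 + 2 * (k d)) / (d:ℝ)) atTop (𝓝 0) := by
      have := ((hX2.pow 2).const_mul 2).add (hk₂.const_mul 2)
      simp only [ne_eq, OfNat.ofNat_ne_zero, not_false_eq_true, zero_pow, mul_zero, add_zero] at this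
      refine this.congr fun d => ?_
      rw [div_pow, Real.sq_sqrt (by positivity)]
      ring
    have h2 := ENNReal.tendsto_ofReal h1
    rw [ENNReal.ofReal_zero] at h2
    refine tendsto_of_tendsto_of_tendsto_of_le_of_le' tendsto_const_nhds
      h2 (Eventually.of_forall fun _ => zero_le) ?_
    filter_upwards [hd1, hkn] with d hd hn
    have := hprob d hd
    exact P_R (hU d hd) hd _ hn _
  -- the norm of rho
  have cr : CP P (fun d ω => ‖rhoF d (k d) (X d) σ ω‖ / √d) σ := by
    have h1 : CP P (fun d ω => ‖rhoF d (k d) (X d) σ ω‖ / √d - σ * √(‖ω.2‖^2 / d - 1 + 1)) 0 := by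
      have h2 : CP P (fun d ω => ‖X d‖ / √d + √(‖∑ i, ω.1 i‖^2 / d)) 0 := by
        have := ((CP.const (P := P) hX2).prodMk cL).map (G := fun p : ℝ × ℝ => p.1 + √p.2)
          (by fun_prop)
        simpa using this
      refine h2.squeeze ?_
      filter_upwards [hd1] with d hd ω
      have hd' : (0:ℝ) < √d := by
        apply Real.sqrt_pos.2; exact_mod_cast hd
      rw [sub_add_cancel, Real.sqrt_div (sq_nonneg _), Real.sqrt_div (sq_nonneg _),
        Real.sqrt_sq (norm_nonneg _), Real.sqrt_sq (norm_nonneg _), ← mul_div_assoc, ← sub_div,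
        ← add_div, abs_div, abs_of_pos hd']
      gcongr
      have h3 : ‖σ • ω.2‖ = σ * ‖ω.2‖ := by rw [norm_smul, Real.norm_eq_abs, abs_of_pos hσ]
      rw [← h3]
      refine (abs_norm_sub_norm_le _ _).trans ?_
      have : rhoF d (k d) (X d) σ ω - σ • ω.2 = X d + ∑ i, ω.1 i := by
        unfold rhoF; abel
      rw [this]
      exact norm_add_le _ _
    have h4 := (h1.prodMk cA).map (G := fun p : ℝ × ℝ => p.1 + σ * √(p.2 + 1)) (by fun_prop)
    simpa using h4
  have inner_eq : ∀ d (ω : (Fin (k d) → EuclideanSpace ℝ (Fin d)) × EuclideanSpace ℝ (Fin d)) i,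
      ⟪ω.1 i, rhoF d (k d) (X d) σ ω⟫_ℝ =
        1 + σ * ⟪ω.1 i, ω.2⟫_ℝ + (⟪ω.1 i, X d + ∑ j, ω.1 j⟫_ℝ - 1) := by
    intro d ω i
    rw [rhoF, inner_add_right _ (X d + _), real_inner_smul_right]
    ring
  have cb : CP P (fun d ω => (1 / (k d) : ℝ) * ∑ i, (⟪ω.1 i, X d + ∑ j, ω.1 j⟫_ℝ - 1)) 0 := by
    have h2 := cR.map (G := Real.sqrt) Real.continuous_sqrt.continuousAt
    rw [Real.sqrt_zero] at h2
    refine h2.squeeze ?_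
    filter_upwards [hkn] with d hn ω
    exact avg_abs_le' hn _
  have cwb : CP P (fun d ω => (1 / (k d) : ℝ) * ∑ i, ⟪ω.1 i, ω.2⟫_ℝ *
      (⟪ω.1 i, X d + ∑ j, ω.1 j⟫_ℝ - 1)) 0 := by
    have h2 := ((cW.prodMk cA).prodMk cR).map
      (G := fun p : (ℝ × ℝ) × ℝ => √(p.1.1 + (p.1.2 + 1)) * √p.2) (by fun_prop)
    simp only [Real.sqrt_zero, mul_zero] at h2
    refine h2.squeeze (Eventually.of_forall fun d ω => ?_)
    refine (avg_abs_le _ _).trans (le_of_eq ?_)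
    congr 2
    ring
  have cN : CP P (fun d ω => (1 / (k d) : ℝ) * ∑ i, ⟪ω.1 i, rhoF d (k d) (X d) σ ω⟫_ℝ) 1 := by
    have h2 := (cB.prodMk cb).map (G := fun p : ℝ × ℝ => 1 + σ * p.1 + p.2) (by fun_prop)
    simp only [mul_zero, add_zero] at h2
    refine h2.congr ?_
    filter_upwards [hkn] with d hn ω
    have hn' : (k d : ℝ) ≠ 0 := by positivity
    simp_rw [inner_eq, Finset.sum_add_distrib, ← Finset.mul_sum]
    simp only [Finset.sum_const, Finset.card_univ, Fintype.card_fin, nsmul_eq_mul]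
    field_simp
  have cM : CP P (fun d ω => (1 / (k d) : ℝ) * ∑ i, ⟪ω.1 i, rhoF d (k d) (X d) σ ω⟫_ℝ^2)
      (1 + σ^2) := by
    have h2 := (((cB.prodMk cb).prodMk (cW.prodMk cA)).prodMk (cR.prodMk cwb)).map
      (G := fun p : ((ℝ × ℝ) × ℝ × ℝ) × ℝ × ℝ => 1 + σ^2 * (p.1.2.1 + (p.1.2.2 + 1)) + p.2.1
        + 2 * σ * p.1.1.1 + 2 * p.1.1.2 + 2 * σ * p.2.2) (by fun_prop)
    simp only [mul_zero, add_zero, zero_add, mul_one] at h2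
    refine h2.congr ?_
    filter_upwards [hkn] with d hn ω
    have hn' : (k d : ℝ) ≠ 0 := by positivity
    have e : ∀ u v : Fin (k d) → ℝ, (1 / (k d) : ℝ) * ∑ i, (1 + σ * u i + v i)^2 =
        1 + σ^2 * ((1 / (k d) : ℝ) * ∑ i, u i ^2) + (1 / (k d) : ℝ) * ∑ i, v i ^2
        + 2 * σ * ((1 / (k d) : ℝ) * ∑ i, u i) + 2 * ((1 / (k d) : ℝ) * ∑ i, v i)
        + 2 * σ * ((1 / (k d) : ℝ) * ∑ i, u i * v i) := by
      intro u v
      have e1 : ∀ i, (1 + σ * u i + v i)^2 = 1 + σ^2 * u i ^2 + v i ^2 + 2 * σ * u i + 2 * v i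
        + 2 * σ * (u i * v i) := fun i => by ring
      simp_rw [e1, Finset.sum_add_distrib, ← Finset.mul_sum]
      simp only [Finset.sum_const, Finset.card_univ, Fintype.card_fin, nsmul_eq_mul]
      field_simp
    simp_rw [inner_eq]
    rw [e]
    ring
  have cF : CP P (fun d ω => (√d * muHat d (k d) (X d) σ ω, d * sigmaHatSq d (k d) (X d) σ ω))
      (1 / σ, 1) := by
    have h2 := ((cN.prodMk cM).prodMk cr).map
      (G := fun p : (ℝ × ℝ) × ℝ => (p.1.1 / p.2, p.1.2 / p.2^2 - (p.1.1 / p.2)^2))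
      (by
        have hs : ((((1:ℝ), 1 + σ^2), σ) : (ℝ × ℝ) × ℝ).2 ≠ 0 := hσ.ne'
        have hs2 : ((((1:ℝ), 1 + σ^2), σ) : (ℝ × ℝ) × ℝ).2^2 ≠ 0 := pow_ne_zero 2 hσ.ne'
        fun_prop (disch := assumption))
    have e : (1 + σ^2) / σ^2 - (1 / σ)^2 = 1 := by field_simp; ring
    simp only [e] at h2
    refine h2.congr ?_
    filter_upwards [hkn] with d hn ω
    rw [sigma_scale d (k d) hn, muHat_scale]
  have cE := cF.map (Feps_cont (1 / σ) hδ₀)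
  intro ε hε
  refine (cE _ (Metric.ball_mem_nhds _ hε)).congr' ?_
  filter_upwards [hd1] with d hd
  congr 1
  ext ω
  simp only [Set.mem_ofPred_eq, Metric.mem_ball, not_lt, Real.dist_eq]
  rw [epsDP_est d hd, epsDP_true σ hσ]
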